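/- Let H(x,y) = (y, y^d − a·x) with d ≥ 2 and a ≠ 0, and let c > 0. An affine map L of ℂ², i.e. L(x,y) = (a₁x + a₂y + a₃, b₁x + b₂y + b₃), satisfies L(Ω_c) = Ω_c if and only if there exists η ∈ ℂ with η^{d²−1} = 1 such that L(x,y) = (η·x, η^d·y) for all (x,y). In particular, the group of affine maps preserving Ω_c is isomorphic to ℤ/(d²−1)ℤ. -/

import Mathlib

open Filter Topology Set

noncomputable section

/-- `L : ℂ² → ℂ²` is an affine map. -/
def IsAffine (L : ℂ × ℂ → ℂ × ℂ) : Prop :=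
  ∃ a₁ a₂ a₃ b₁ b₂ b₃ : ℂ, ∀ z : ℂ × ℂ,
    L z = (a₁ * z.1 + a₂ * z.2 + a₃, b₁ * z.1 + b₂ * z.2 + b₃)


lemma green_comp (d : ℕ) (hd : 2 ≤ d) (H : ℂ × ℂ → ℂ × ℂ)
    (G : ℂ × ℂ → ℝ)
    (hGlim : ∀ z : ℂ × ℂ,
      Tendsto (fun n : ℕ => Real.log (max ‖H^[n] z‖ 1) / (d : ℝ) ^ n) atTop (𝓝 (G z)))
    (z : ℂ × ℂ) : G (H z) = d * G z := by
  have h1 := hGlim (H z)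
  have h2 := ((hGlim z).comp (tendsto_add_atTop_nat 1)).const_mul (d : ℝ)
  refine tendsto_nhds_unique h1 (h2.congr fun n => ?_)
  have : (d : ℝ) ≠ 0 := by positivity
  simp only [Function.comp, Function.iterate_succ_apply, pow_succ]
  field_simp

lemma green_iter (d : ℕ) (hd : 2 ≤ d) (H : ℂ × ℂ → ℂ × ℂ)
    (G : ℂ × ℂ → ℝ)
    (hGlim : ∀ z : ℂ × ℂ,
      Tendsto (fun n : ℕ => Real.log (max ‖H^[n] z‖ 1) / (d : ℝ) ^ n) atTop (𝓝 (G z)))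
    (k : ℕ) (z : ℂ × ℂ) : G (H^[k] z) = (d : ℝ) ^ k * G z := by
  induction k with
  | zero => simp
  | succ k ih =>
    rw [Function.iterate_succ_apply', green_comp d hd H G hGlim, ih]; ring

lemma growth_step (d : ℕ) (hd : 2 ≤ d) (a x y : ℂ) (hy : 4 + 2 * ‖a‖ ≤ ‖y‖) (hxy : ‖x‖ ≤ ‖y‖) :
    ‖y‖ ≤ ‖y ^ d - a * x‖ ∧ (‖y‖ / 2) ^ d ≤ ‖y ^ d - a * x‖ / 2 := by
  have ha := norm_nonneg a
  have h1 : ‖y‖ ^ d - ‖a‖ * ‖y‖ ≤ ‖y ^ d - a * x‖ := by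
    have := norm_sub_norm_le (y ^ d) (a * x)
    rw [norm_pow, norm_mul] at this
    have h := mul_le_mul_of_nonneg_left hxy ha
    linarith
  have h2 : ‖y‖ ^ 2 ≤ ‖y‖ ^ d := pow_le_pow_right₀ (by linarith) hd
  have h3 : ‖y‖ ^ d / 2 ≤ ‖y ^ d - a * x‖ := by nlinarith
  refine ⟨by nlinarith, ?_⟩
  rw [div_pow]
  have h4 : (2 : ℝ) ^ 2 ≤ 2 ^ d := pow_le_pow_right₀ (by norm_num) hd
  have h5 : ‖y‖ ^ d / 2 ^ d ≤ ‖y‖ ^ d / 2 ^ 2 := by gcongr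
  linarith

lemma green_lower (d : ℕ) (hd : 2 ≤ d) (a : ℂ) (H : ℂ × ℂ → ℂ × ℂ)
    (hH : ∀ z : ℂ × ℂ, H z = (z.2, z.2 ^ d - a * z.1))
    (G : ℂ × ℂ → ℝ)
    (hGlim : ∀ z : ℂ × ℂ,
      Tendsto (fun n : ℕ => Real.log (max ‖H^[n] z‖ 1) / (d : ℝ) ^ n) atTop (𝓝 (G z)))
    (z : ℂ × ℂ) (hy : 4 + 2 * ‖a‖ ≤ ‖z.2‖) (hxy : ‖z.1‖ ≤ ‖z.2‖) :
    Real.log (‖z.2‖ / 2) ≤ G z := by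
  have ha := norm_nonneg a
  have key : ∀ n, 4 + 2 * ‖a‖ ≤ ‖(H^[n] z).2‖ ∧ ‖(H^[n] z).1‖ ≤ ‖(H^[n] z).2‖ ∧
      (‖z.2‖ / 2) ^ (d ^ n) ≤ ‖(H^[n] z).2‖ / 2 := by
    intro n
    induction n with
    | zero => simp [hy, hxy]
    | succ n ih =>
      obtain ⟨i1, i2, i3⟩ := ih
      rw [Function.iterate_succ_apply', hH]
      obtain ⟨g1, g2⟩ := growth_step d hd a _ _ i1 i2
      refine ⟨i1.trans g1, g1, ?_⟩
      rw [pow_succ, pow_mul]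
      exact (pow_le_pow_left₀ (by positivity) i3 d).trans g2
  refine ge_of_tendsto' (hGlim z) fun n => ?_
  obtain ⟨i1, i2, i3⟩ := key n
  rw [le_div_iff₀ (by positivity), mul_comm]
  have : (d : ℝ) ^ n * Real.log (‖z.2‖ / 2) = Real.log ((‖z.2‖ / 2) ^ (d ^ n)) := by
    rw [Real.log_pow]; push_cast; rfl
  rw [this]
  apply Real.log_le_log
  · apply pow_pos; linarith
  · refine i3.trans ?_
    have := norm_snd_le (H^[n] z)
    have := le_max_left ‖H^[n] z‖ 1
    have := norm_nonneg (H^[n] z).2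
    linarith

lemma green_bound (d : ℕ) (hd : 2 ≤ d) (a : ℂ) (H : ℂ × ℂ → ℂ × ℂ)
    (hH : ∀ z : ℂ × ℂ, H z = (z.2, z.2 ^ d - a * z.1))
    (G : ℂ × ℂ → ℝ)
    (hGlim : ∀ z : ℂ × ℂ,
      Tendsto (fun n : ℕ => Real.log (max ‖H^[n] z‖ 1) / (d : ℝ) ^ n) atTop (𝓝 (G z)))
    (c : ℝ) (hc : 0 < c) :
    ∃ M : ℝ, ∀ z, G z < c → ∀ k ≤ 4, ‖(H^[k] z).2‖ ≤ max ‖(H^[k] z).1‖ M := by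
  refine ⟨max (4 + 2 * ‖a‖) (2 * Real.exp ((d : ℝ) ^ 4 * c)), fun z hz k hk => ?_⟩
  by_contra! hcon
  rw [max_lt_iff, max_lt_iff] at hcon
  obtain ⟨h1, h2, h3⟩ := hcon
  have h4 := green_lower d hd a H hH G hGlim (H^[k] z) h2.le h1.le
  rw [green_iter d hd H G hGlim] at h4
  have h5 : (d : ℝ) ^ k * G z ≤ (d : ℝ) ^ 4 * c := by
    have hd1 : (1 : ℝ) ≤ d := by exact_mod_cast (by omega : 1 ≤ d)
    have : (d : ℝ) ^ k ≤ (d : ℝ) ^ 4 := pow_le_pow_right₀ hd1 hk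
    calc (d : ℝ) ^ k * G z ≤ (d : ℝ) ^ k * c := by gcongr
      _ ≤ _ := by gcongr
  have h6 : (d : ℝ) ^ 4 * c < Real.log (‖(H^[k] z).2‖ / 2) := by
    rw [Real.lt_log_iff_exp_lt]
    · linarith
    · have := norm_nonneg a
      linarith
  linarith

def bk (d : ℕ) (a : ℂ) : ℕ → ℂ × ℂ
  | 0 => (((2 + 2 * ‖a‖ : ℝ) : ℂ), 0)
  | n + 1 => (((bk d a n).1 ^ d - (bk d a n).2) / a, (bk d a n).1)

lemma bk_step (d : ℕ) (hd : 2 ≤ d) (a : ℂ) (ha : a ≠ 0) (x y : ℂ) (hx : 2 + 2 * ‖a‖ ≤ ‖x‖)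
    (hyx : ‖y‖ ≤ ‖x‖) : ‖x‖ * (‖x‖ - 1) ≤ ‖a‖ * ‖(x ^ d - y) / a‖ ∧ 2 * ‖x‖ ≤ ‖(x ^ d - y) / a‖ := by
  have ha' : 0 < ‖a‖ := norm_pos_iff.mpr ha
  have h0 : ‖a‖ * ‖(x ^ d - y) / a‖ = ‖x ^ d - y‖ := by
    rw [norm_div]; field_simp
  have h1 := norm_sub_norm_le (x ^ d) y
  rw [norm_pow] at h1
  have h2 : ‖x‖ ^ 2 ≤ ‖x‖ ^ d := pow_le_pow_right₀ (by linarith) hd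
  have h3 : ‖x‖ * (‖x‖ - 1) ≤ ‖a‖ * ‖(x ^ d - y) / a‖ := by rw [h0]; nlinarith
  refine ⟨h3, ?_⟩
  have : ‖a‖ * (2 * ‖x‖) ≤ ‖a‖ * ‖(x ^ d - y) / a‖ := by nlinarith
  exact le_of_mul_le_mul_left this ha'

lemma exists_backward (d : ℕ) (hd : 2 ≤ d) (a : ℂ) (ha : a ≠ 0) (H : ℂ × ℂ → ℂ × ℂ)
    (hH : ∀ z : ℂ × ℂ, H z = (z.2, z.2 ^ d - a * z.1))
    (G : ℂ × ℂ → ℝ)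
    (hGlim : ∀ z : ℂ × ℂ,
      Tendsto (fun n : ℕ => Real.log (max ‖H^[n] z‖ 1) / (d : ℝ) ^ n) atTop (𝓝 (G z)))
    (c : ℝ) (hc : 0 < c) :
    ∃ v : ℕ → ℂ, (∀ n, a * v (n + 2) = v (n + 1) ^ d - v n) ∧
      Tendsto (fun n => ‖v n‖) atTop atTop ∧
      (v =o[atTop] fun n => v (n + 1)) ∧ ∀ n, G (v (n + 1), v n) < c := by
  have ha' : 0 < ‖a‖ := norm_pos_iff.mpr ha
  have inv : ∀ n, 2 + 2 * ‖a‖ ≤ ‖(bk d a n).1‖ ∧ ‖(bk d a n).2‖ ≤ ‖(bk d a n).1‖ := by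
    intro n
    induction n with
    | zero =>
      simp only [bk, Complex.norm_real, norm_zero, Real.norm_eq_abs]
      exact ⟨le_abs_self _, abs_nonneg _⟩
    | succ n ih =>
      obtain ⟨-, h⟩ := bk_step d hd a ha _ _ ih.1 ih.2
      simp only [bk]
      constructor <;> linarith [ih.1]
  have hHbk : ∀ n, H (bk d a (n + 1)) = bk d a n := by
    intro n
    rw [hH]
    simp only [bk]
    ext
    · rfl
    · simp only; field_simp; ring
  have hGbk : ∀ n, G (bk d a n) = G (bk d a 0) / (d : ℝ) ^ n := by
    intro n
    induction n with
    | zero => simp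
    | succ n ih =>
      have := green_comp d hd H G hGlim (bk d a (n + 1))
      rw [hHbk, ih] at this
      have hd0 : (d : ℝ) ≠ 0 := by positivity
      rw [pow_succ]
      field_simp at this ⊢
      linarith
  have hlim : Tendsto (fun n => G (bk d a n)) atTop (𝓝 0) := by
    have hd1 : (1 : ℝ) < d := by exact_mod_cast (by omega : 1 < d)
    have := (tendsto_pow_atTop_atTop_of_one_lt hd1).const_div_atTop (G (bk d a 0))
    exact this.congr fun n => (hGbk n).symm
  obtain ⟨N, hN⟩ := eventually_atTop.mp (hlim.eventually_lt_const hc)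
  have hfst : ∀ n, (bk d a n).1 = (bk d a (n + 1)).2 := fun n => rfl
  have hdouble : ∀ n, 2 * ‖(bk d a n).1‖ ≤ ‖(bk d a (n + 1)).1‖ := fun n =>
    (bk_step d hd a ha _ _ (inv n).1 (inv n).2).2
  have hgeo : ∀ n : ℕ, (2 : ℝ) ^ n ≤ ‖(bk d a n).1‖ := by
    intro n
    induction n with
    | zero => have := (inv 0).1; rw [pow_zero]; linarith
    | succ n ih => rw [pow_succ]; linarith [hdouble n]
  have htend : Tendsto (fun n => ‖(bk d a n).1‖) atTop atTop :=
    tendsto_atTop_mono hgeo (tendsto_pow_atTop_atTop_of_one_lt (by norm_num))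
  have hlo : (fun n => (bk d a n).1) =o[atTop] fun n => (bk d a (n + 1)).1 := by
    rw [Asymptotics.isLittleO_iff]
    intro ε hε
    filter_upwards [htend.eventually_ge_atTop (1 + ‖a‖ / ε)] with n hn
    have h1 := (bk_step d hd a ha _ _ (inv n).1 (inv n).2).1
    change _ ≤ ‖a‖ * ‖(bk d a (n + 1)).1‖ at h1
    have h2 : ‖a‖ ≤ ε * (‖(bk d a n).1‖ - 1) := by
      have : ‖a‖ = ε * (‖a‖ / ε) := by field_simp
      rw [this]
      gcongr
      linarith
    have h3 := mul_le_mul_of_nonneg_left h1 hε.le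
    have h4 := mul_le_mul_of_nonneg_right h2 (norm_nonneg (bk d a n).1)
    have : ‖a‖ * ‖(bk d a n).1‖ ≤ ‖a‖ * (ε * ‖(bk d a (n + 1)).1‖) := by linarith
    exact le_of_mul_le_mul_left this ha'
  refine ⟨fun n => (bk d a (n + (N + 1))).2, fun n => ?_, ?_, ?_, fun n => ?_⟩
  · have e1 : n + 2 + (N + 1) = (n + (N + 1)) + 1 + 1 := by ring
    have e2 : n + 1 + (N + 1) = (n + (N + 1)) + 1 := by ring
    beta_reduce
    rw [e1, e2]
    generalize n + (N + 1) = m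
    simp only [bk]
    field_simp
  · exact htend.comp (tendsto_add_atTop_nat N)
  · have := hlo.comp_tendsto (tendsto_add_atTop_nat N)
    refine this.congr (fun n => rfl) (fun n => ?_)
    have e2 : n + 1 + (N + 1) = n + N + 1 + 1 := by ring
    beta_reduce
    rw [e2]; rfl
  · have e2 : n + 1 + (N + 1) = n + (N + 1) + 1 := by ring
    have := hN (n + (N + 1)) (by omega)
    beta_reduce
    rw [e2]
    exact this

lemma one_bigO {t : ℕ → ℂ} (ht : Tendsto (fun n => ‖t n‖) atTop atTop) (b : ℂ) :
    (fun _ => b : ℕ → ℂ) =o[atTop] t := by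
  exact Asymptotics.isLittleO_const_left.mpr (Or.inr ht)

lemma bigO_max {t A B : ℕ → ℂ} (ht : Tendsto (fun n => ‖t n‖) atTop atTop)
    (hA : A =O[atTop] t) (M : ℝ) (hB : ∀ n, ‖B n‖ ≤ max ‖A n‖ M) : B =O[atTop] t := by
  have h1 : (fun _ => (M : ℂ) : ℕ → ℂ) =O[atTop] t := (one_bigO ht _).isBigO
  have h2 : (fun n => ‖A n‖ + ‖(M : ℂ)‖) =O[atTop] t := hA.norm_left.add h1.norm_left
  refine (Asymptotics.IsBigO.of_bound 1 (Eventually.of_forall fun n => ?_)).trans h2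
  rw [one_mul, Real.norm_eq_abs]
  refine (hB n).trans (le_trans ?_ (le_abs_self _))
  rw [Complex.norm_real]
  have := norm_nonneg (A n)
  have := norm_nonneg M
  have := Real.le_norm_self M
  apply max_le <;> linarith

lemma littleO_of_pow {d : ℕ} (hd : 2 ≤ d) {t B : ℕ → ℂ}
    (ht : Tendsto (fun n => ‖t n‖) atTop atTop)
    (hB : (fun n => B n ^ d) =O[atTop] t) : B =o[atTop] t := by
  obtain ⟨C, hC⟩ := hB.bound
  rw [Asymptotics.isLittleO_iff]
  intro ε hε
  filter_upwards [hC, ht.eventually_ge_atTop 1, ht.eventually_ge_atTop ((|C| + 1) / ε ^ 2)]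
    with n h1 h2 h3
  rw [norm_pow] at h1
  have h4 : ‖B n‖ ^ 2 ≤ 1 + |C| * ‖t n‖ := by
    have h5 : C * ‖t n‖ ≤ |C| * ‖t n‖ := by gcongr; exact le_abs_self C
    have h6 : 0 ≤ |C| * ‖t n‖ := by positivity
    rcases le_total ‖B n‖ 1 with h | h
    · have : ‖B n‖ ^ 2 ≤ 1 := pow_le_one₀ (norm_nonneg _) h
      linarith
    · have : ‖B n‖ ^ 2 ≤ ‖B n‖ ^ d := pow_le_pow_right₀ h hd
      linarith
  rw [div_le_iff₀ (by positivity)] at h3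
  refine le_of_sq_le_sq ?_ (by positivity)
  rw [mul_pow]
  nlinarith

lemma key_littleO {d : ℕ} (hd : 2 ≤ d) (a : ℂ) {t A B B' : ℕ → ℂ}
    (ht : Tendsto (fun n => ‖t n‖) atTop atTop) (M : ℝ)
    (hA : A =O[atTop] t) (hB : ∀ n, ‖B n‖ ≤ max ‖A n‖ M) (hB' : ∀ n, ‖B' n‖ ≤ max ‖B n‖ M)
    (hrec : ∀ n, B' n = B n ^ d - a * A n) : B =o[atTop] t := by
  have h1 := bigO_max ht hA M hB
  have h2 := bigO_max ht h1 M hB'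
  refine littleO_of_pow hd ht ?_
  refine (h2.add (hA.const_mul_left a)).congr_left fun n => ?_
  rw [hrec]; ring

open Polynomial in
lemma poly_const {t s B : ℕ → ℂ} (ht : Tendsto (fun n => ‖t n‖) atTop atTop) (p : ℂ[X]) (k : ℂ)
    (hs : s =o[atTop] t) (hB : B =o[atTop] t) (h : ∀ n, B n = p.eval (t n) + k * s n) :
    p = C (p.eval 0) := by
  have h1 : (fun n => p.eval (t n) - p.eval 0) =o[atTop] t := by
    refine ((hB.sub (hs.const_mul_left k)).sub (one_bigO ht (p.eval 0))).congr_left fun n => ?_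
    rw [h]; ring
  have hp := p.divX_mul_X_add
  have h2 : Tendsto (fun n => (p.divX).eval (t n)) atTop (𝓝 0) := by
    refine h1.tendsto_div_nhds_zero.congr' ?_
    filter_upwards [ht.eventually_ge_atTop 1] with n hn
    have hne : t n ≠ 0 := by intro h0; rw [h0] at hn; simp at hn; linarith
    rw [div_eq_iff hne, ← coeff_zero_eq_eval_zero]
    nth_rewrite 1 [← hp]
    simp
  have h3 : p.divX.degree ≤ 0 := by
    by_contra! hpos
    exact not_tendsto_nhds_of_tendsto_atTop (p.divX.tendsto_norm_atTop hpos ht) _ h2.norm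
  rw [degree_le_zero_iff.mp h3] at h2 hp
  simp only [eval_C] at h2
  have h4 : p.divX.coeff 0 = 0 := tendsto_nhds_unique tendsto_const_nhds h2
  rw [h4] at hp
  rw [← coeff_zero_eq_eval_zero]
  simpa using hp.symm

open Polynomial in
lemma poly_id {d : ℕ} (hd : 2 ≤ d) {α β γ δ e : ℂ} (hα : α ≠ 0)
    (h : (C α * X + C β) ^ d - C γ * X ^ d - C δ = C e) : β = 0 ∧ α ^ d = γ := by
  have hβ : β = 0 := by
    have h1 := congrArg (fun p => (derivative p).eval 0) h
    have hd1 : d - 1 ≠ 0 := by omega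
    have hd0 : (d : ℂ) ≠ 0 := by exact_mod_cast (by omega : d ≠ 0)
    simp [derivative_pow, hd1, hα, hd0] at h1
    exact h1
  subst hβ
  refine ⟨rfl, ?_⟩
  have h0 := congrArg (fun p => p.eval 0) h
  have h1 := congrArg (fun p => p.eval 1) h
  simp [show d ≠ 0 by omega] at h0 h1
  linear_combination h1 - h0

open Polynomial in
lemma affine_rigid (d : ℕ) (hd : 2 ≤ d) (a : ℂ) (ha : a ≠ 0) (H : ℂ × ℂ → ℂ × ℂ)
    (hH : ∀ z : ℂ × ℂ, H z = (z.2, z.2 ^ d - a * z.1))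
    (G : ℂ × ℂ → ℝ)
    (hGlim : ∀ z : ℂ × ℂ,
      Tendsto (fun n : ℕ => Real.log (max ‖H^[n] z‖ 1) / (d : ℝ) ^ n) atTop (𝓝 (G z)))
    (c : ℝ) (hc : 0 < c) (L : ℂ × ℂ → ℂ × ℂ) (hL : IsAffine L)
    (hLG : L '' {z : ℂ × ℂ | G z < c} = {z : ℂ × ℂ | G z < c}) :
    ∃ η : ℂ, η ^ (d ^ 2 - 1) = 1 ∧ ∀ z : ℂ × ℂ, L z = (η * z.1, η ^ d * z.2) := by
  obtain ⟨a₁, a₂, a₃, b₁, b₂, b₃, hL⟩ := hL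
  obtain ⟨v, hrec, hinf, hlo, hG⟩ := exists_backward d hd a ha H hH G hGlim c hc
  obtain ⟨M, hM⟩ := green_bound d hd a H hH G hGlim c hc
  set Y : ℕ → ℕ → ℂ := fun k n => (H^[k] (L (v (n + 4), v (n + 3)))).1 with hY
  have hY2 : ∀ k n, (H^[k] (L (v (n + 4), v (n + 3)))).2 = Y (k + 1) n := by
    intro k n
    simp only [hY]
    rw [Function.iterate_succ_apply', hH]
  have hYrec : ∀ k n, Y (k + 2) n = Y (k + 1) n ^ d - a * Y k n := by
    intro k n
    rw [← hY2 (k + 1), Function.iterate_succ_apply', hH, ← hY2 k]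
  have hYb : ∀ k ≤ 4, ∀ n, ‖Y (k + 1) n‖ ≤ max ‖Y k n‖ M := by
    intro k hk n
    rw [← hY2]
    refine hM _ ?_ k hk
    have : L (v (n + 4), v (n + 3)) ∈ {z : ℂ × ℂ | G z < c} := by
      rw [← hLG]; exact ⟨_, hG (n + 3), rfl⟩
    exact this
  have hY0 : ∀ n, Y 0 n = a₁ * v (n + 4) + a₂ * v (n + 3) + a₃ := by
    intro n; simp [hY, hL]
  have hY1 : ∀ n, Y 1 n = b₁ * v (n + 4) + b₂ * v (n + 3) + b₃ := by
    intro n; rw [← hY2]; simp [hL]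
  have hinfk : ∀ k, Tendsto (fun n => ‖v (n + k)‖) atTop atTop := fun k =>
    hinf.comp (tendsto_add_atTop_nat k)
  have hlok : ∀ k, (fun n => v (n + k)) =o[atTop] fun n => v (n + (k + 1)) := fun k =>
    hlo.comp_tendsto (tendsto_add_atTop_nat k)
  have hself : ∀ k, (fun n => v (n + k)) =O[atTop] fun n => v (n + k) := fun k =>
    Asymptotics.isBigO_refl _ _
  -- first step: b₁ = 0
  have hb₁ : b₁ = 0 := by
    have hA : Y 0 =O[atTop] fun n => v (n + 4) := by
      refine ((((hself 4).const_mul_left a₁).add ((hlok 3).isBigO.const_mul_left a₂)).add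
        (one_bigO (hinfk 4) a₃).isBigO).congr_left fun n => ?_
      rw [hY0]
    have hB := key_littleO hd a (hinfk 4) M hA (hYb 0 (by norm_num)) (hYb 1 (by norm_num))
      (hYrec 0)
    have := poly_const (hinfk 4) (C b₁ * X + C b₃) b₂ (hlok 3) hB (fun n => by
      rw [hY1]; simp; ring)
    have := congrArg (fun p => coeff p 1) this
    simpa using this
  subst hb₁
  simp only [zero_mul, zero_add] at hY1 hL
  -- second step
  have hA1 : Y 1 =O[atTop] fun n => v (n + 3) := by
    refine (((hself 3).const_mul_left b₂).add
      (one_bigO (hinfk 3) b₃).isBigO).congr_left fun n => ?_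
    rw [hY1]
  have hB1 := key_littleO hd a (hinfk 3) M hA1 (hYb 1 (by norm_num)) (hYb 2 (by norm_num))
    (hYrec 1)
  set P : ℂ[X] := (C b₂ * X + C b₃) ^ d - C a₁ * X ^ d - C (a * a₂) * X - C (a * a₃) with hP
  have hY2P : ∀ n, Y 2 n = P.eval (v (n + 3)) + a₁ * v (n + 2) := by
    intro n
    have h := hrec (n + 2)
    rw [hYrec 0, hY1, hY0]
    simp [hP]
    linear_combination (-a₁) * h
  have hPc := poly_const (hinfk 3) P a₁ (hlok 2) hB1 hY2P
  obtain ⟨e, he⟩ : ∃ e, e = P.eval 0 := ⟨_, rfl⟩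
  rw [← he] at hPc
  have hba : b₂ ^ d = a₁ := by
    have h := congrArg (fun p => coeff p d) hPc
    have h1 : ((C b₂ * X + C b₃) ^ d).coeff d = b₂ ^ d := by
      have := coeff_pow_of_natDegree_le (p := C b₂ * X + C b₃) (n := 1) (m := d)
        natDegree_linear_le
      simpa using this
    have hd1 : (1 : ℕ) ≠ d := by omega
    have hd0 : d ≠ 0 := by omega
    simp only [hP, coeff_sub, h1, coeff_C_mul, coeff_X_pow, coeff_X, coeff_C, hd1, hd0] at h
    simp at h
    linear_combination h
  have hb₂ : b₂ ≠ 0 := by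
    intro hb
    have hall : ∀ n, v n = b₃ := by
      intro n
      have : (v (n + 1), v n) ∈ L '' {z : ℂ × ℂ | G z < c} := by rw [hLG]; exact hG n
      obtain ⟨z, -, hz⟩ := this
      rw [hL, hb] at hz
      have := congrArg Prod.snd hz
      simpa using this.symm
    simp only [hall] at hinf
    exact not_tendsto_nhds_of_tendsto_atTop hinf _ tendsto_const_nhds
  have ha₁ : a₁ ≠ 0 := by rw [← hba]; exact pow_ne_zero _ hb₂
  have hY2' : ∀ n, Y 2 n = a₁ * v (n + 2) + e := by
    intro n; rw [hY2P, hPc]; simp; ring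
  -- third step
  have hA2 : Y 2 =O[atTop] fun n => v (n + 2) := by
    refine (((hself 2).const_mul_left a₁).add
      (one_bigO (hinfk 2) e).isBigO).congr_left fun n => ?_
    rw [hY2']
  have hB2 := key_littleO hd a (hinfk 2) M hA2 (hYb 2 (by norm_num)) (hYb 3 (by norm_num))
    (hYrec 2)
  have hQ := poly_const (hinfk 2) ((C a₁ * X + C e) ^ d - C b₂ * X ^ d - C (a * b₃)) b₂ (hlok 1)
    hB2 (fun n => by
      have h := hrec (n + 1)
      rw [hYrec 1, hY2', hY1]
      simp
      linear_combination (-b₂) * h)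
  obtain ⟨he0, hab⟩ := poly_id hd ha₁ hQ
  rw [he0] at hY2' hPc
  have hY3' : ∀ n, Y 3 n = b₂ * v (n + 1) + -(a * b₃) := by
    intro n
    have h := hrec (n + 1)
    rw [hYrec 1, hY2', hY1]
    simp only [add_zero, mul_pow]
    rw [hab]
    linear_combination (-b₂) * h
  -- fourth step
  have hA3 : Y 3 =O[atTop] fun n => v (n + 1) := by
    refine (((hself 1).const_mul_left b₂).add
      (one_bigO (hinfk 1) (-(a * b₃))).isBigO).congr_left fun n => ?_
    rw [hY3']
  have hB3 := key_littleO hd a (hinfk 1) M hA3 (hYb 3 (by norm_num)) (hYb 4 (by norm_num))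
    (hYrec 3)
  have hR := poly_const (hinfk 1) ((C b₂ * X + C (-(a * b₃))) ^ d - C a₁ * X ^ d - C 0) a₁ (hlok 0)
    hB3 (fun n => by
      have h := hrec n
      rw [hYrec 2, hY3', hY2']
      simp
      linear_combination (-a₁) * h)
  obtain ⟨hb30, -⟩ := poly_id hd hb₂ hR
  have hb₃ : b₃ = 0 := by simpa [ha] using hb30
  have ha₂₃ : a₂ = 0 ∧ a₃ = 0 := by
    have hP1 : -(C (a * a₂) * X) - C (a * a₃) = (0 : ℂ[X]) := by
      have : P = -(C (a * a₂) * X) - C (a * a₃) := by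
        rw [hP, hb₃, ← hba, C_pow, C_0]; ring
      rw [← this, hPc, C_0]
    have h0 := congrArg (fun p => coeff p 0) hP1
    have h1 := congrArg (fun p => coeff p 1) hP1
    simp [ha] at h0
    simp [ha, coeff_C] at h1
    exact ⟨h1, h0⟩
  obtain ⟨ha₂, ha₃⟩ := ha₂₃
  refine ⟨a₁, ?_, fun z => ?_⟩
  · have h1 : a₁ ^ (d ^ 2) = a₁ := by rw [pow_two, pow_mul, hab, hba]
    have h2 : d ^ 2 = (d ^ 2 - 1) + 1 := by
      have : 0 < d ^ 2 := by positivity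
      omega
    rw [h2, pow_succ] at h1
    exact mul_right_cancel₀ ha₁ (by rw [h1, one_mul])
  · rw [hL, ha₂, ha₃, hb₃, hab]; simp

lemma diag_green (d : ℕ) (hd : 2 ≤ d) (a : ℂ) (H : ℂ × ℂ → ℂ × ℂ)
    (hH : ∀ z : ℂ × ℂ, H z = (z.2, z.2 ^ d - a * z.1))
    (G : ℂ × ℂ → ℝ)
    (hGlim : ∀ z : ℂ × ℂ,
      Tendsto (fun n : ℕ => Real.log (max ‖H^[n] z‖ 1) / (d : ℝ) ^ n) atTop (𝓝 (G z)))
    (η : ℂ) (hη : η ^ (d ^ 2 - 1) = 1) (z : ℂ × ℂ) : G (η * z.1, η ^ d * z.2) = G z := by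
  have hpos : d ^ 2 = (d ^ 2 - 1) + 1 := by
    have : 0 < d ^ 2 := by positivity
    omega
  have hne : d ^ 2 - 1 ≠ 0 := by nlinarith [Nat.sub_add_cancel (by nlinarith : 1 ≤ d ^ 2)]
  have hpow : ∀ ξ : ℂ, ξ ^ (d ^ 2 - 1) = 1 → ξ ^ (d ^ 2) = ξ := by
    intro ξ h; rw [hpos, pow_succ, h, one_mul]
  have key : ∀ n, ∃ ξ : ℂ, ξ ^ (d ^ 2 - 1) = 1 ∧
      H^[n] (η * z.1, η ^ d * z.2) = (ξ * (H^[n] z).1, ξ ^ d * (H^[n] z).2) := by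
    intro n
    induction n with
    | zero => exact ⟨η, hη, rfl⟩
    | succ n ih =>
      obtain ⟨ξ, h1, h2⟩ := ih
      refine ⟨ξ ^ d, by rw [← pow_mul, mul_comm, pow_mul, h1, one_pow], ?_⟩
      rw [Function.iterate_succ_apply', Function.iterate_succ_apply', h2, hH, hH]
      ext
      · rfl
      · simp only
        rw [mul_pow, ← pow_mul, ← pow_two, hpow ξ h1]
        ring
  refine tendsto_nhds_unique (hGlim _) ((hGlim z).congr fun n => ?_)
  obtain ⟨ξ, h1, h2⟩ := key n
  have h3 : ‖ξ‖ = 1 := Complex.norm_eq_one_of_pow_eq_one h1 hne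
  rw [h2, Prod.norm_def, Prod.norm_def]
  simp [h3]

lemma diag_image (d : ℕ) (hd : 2 ≤ d) (a : ℂ) (H : ℂ × ℂ → ℂ × ℂ)
    (hH : ∀ z : ℂ × ℂ, H z = (z.2, z.2 ^ d - a * z.1))
    (G : ℂ × ℂ → ℝ)
    (hGlim : ∀ z : ℂ × ℂ,
      Tendsto (fun n : ℕ => Real.log (max ‖H^[n] z‖ 1) / (d : ℝ) ^ n) atTop (𝓝 (G z)))
    (c : ℝ) (η : ℂ) (hη : η ^ (d ^ 2 - 1) = 1) (L : ℂ × ℂ → ℂ × ℂ)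
    (hL : ∀ z : ℂ × ℂ, L z = (η * z.1, η ^ d * z.2)) :
    L '' {z : ℂ × ℂ | G z < c} = {z : ℂ × ℂ | G z < c} := by
  have hne : d ^ 2 - 1 ≠ 0 := by nlinarith [Nat.sub_add_cancel (by nlinarith : 1 ≤ d ^ 2)]
  have hη0 : η ≠ 0 := by
    rintro rfl
    rw [zero_pow hne] at hη
    exact zero_ne_one hη
  ext z
  constructor
  · rintro ⟨w, hw, rfl⟩
    rw [mem_setOf_eq, hL, diag_green d hd a H hH G hGlim η hη]
    exact hw
  · intro hz
    refine ⟨(η⁻¹ * z.1, η⁻¹ ^ d * z.2), ?_, ?_⟩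
    · rw [mem_setOf_eq, diag_green d hd a H hH G hGlim η⁻¹ (by rw [inv_pow, hη, inv_one])]
      exact hz
    · rw [hL]
      ext
      · simp [hη0]
      · simp [hη0]

/-- For `H(x,y) = (y, y^d - a·x)` with `d ≥ 2`, `a ≠ 0` and `c > 0`,
an affine map `L` of `ℂ²` satisfies `L(Ω_c) = Ω_c` if and only if there is `η ∈ ℂ`
with `η^(d²-1) = 1` and `L(x,y) = (η·x, η^d·y)`. In particular, the group of affine
maps preserving `Ω_c` is isomorphic to `ℤ/(d²-1)ℤ`. -/
theorem stmt_9 (d : ℕ) (hd : 2 ≤ d) (a : ℂ) (ha : a ≠ 0)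
    (H : ℂ × ℂ → ℂ × ℂ) (hH : ∀ z : ℂ × ℂ, H z = (z.2, z.2 ^ d - a * z.1))
    (G : ℂ × ℂ → ℝ) (hGcont : Continuous G) (hGnonneg : ∀ z, 0 ≤ G z)
    (hGlim : ∀ z : ℂ × ℂ,
      Tendsto (fun n : ℕ => Real.log (max ‖H^[n] z‖ 1) / (d : ℝ) ^ n) atTop (𝓝 (G z)))
    (c : ℝ) (hc : 0 < c) :
    (∀ L : ℂ × ℂ → ℂ × ℂ, IsAffine L →
      (L '' {z : ℂ × ℂ | G z < c} = {z : ℂ × ℂ | G z < c} ↔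
        ∃ η : ℂ, η ^ (d ^ 2 - 1) = 1 ∧ ∀ z : ℂ × ℂ, L z = (η * z.1, η ^ d * z.2))) ∧
    (∃ ι : (ℂ × ℂ → ℂ × ℂ) → ZMod (d ^ 2 - 1),
      (∀ L L', IsAffine L → L '' {z : ℂ × ℂ | G z < c} = {z : ℂ × ℂ | G z < c} →
        IsAffine L' → L' '' {z : ℂ × ℂ | G z < c} = {z : ℂ × ℂ | G z < c} →
        ι (L ∘ L') = ι L + ι L') ∧
      (∀ L L', IsAffine L → L '' {z : ℂ × ℂ | G z < c} = {z : ℂ × ℂ | G z < c} →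
        IsAffine L' → L' '' {z : ℂ × ℂ | G z < c} = {z : ℂ × ℂ | G z < c} →
        ι L = ι L' → L = L') ∧
      (∀ m : ZMod (d ^ 2 - 1), ∃ L, IsAffine L ∧
        L '' {z : ℂ × ℂ | G z < c} = {z : ℂ × ℂ | G z < c} ∧ ι L = m)) := by
  have hmain : ∀ L : ℂ × ℂ → ℂ × ℂ, IsAffine L →
      (L '' {z : ℂ × ℂ | G z < c} = {z : ℂ × ℂ | G z < c} ↔
        ∃ η : ℂ, η ^ (d ^ 2 - 1) = 1 ∧ ∀ z : ℂ × ℂ, L z = (η * z.1, η ^ d * z.2)) := by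
    intro L hL
    constructor
    · exact affine_rigid d hd a ha H hH G hGlim c hc L hL
    · rintro ⟨η, hη, h⟩
      exact diag_image d hd a H hH G hGlim c η hη L h
  refine ⟨hmain, ?_⟩
  have hne : d ^ 2 - 1 ≠ 0 := by nlinarith [Nat.sub_add_cancel (by nlinarith : 1 ≤ d ^ 2)]
  generalize hNdef : d ^ 2 - 1 = N at *
  haveI : NeZero N := ⟨hne⟩
  have hζ := Complex.isPrimitiveRoot_exp N hne
  generalize Complex.exp (2 * Real.pi * Complex.I / N) = ζ at hζ
  have hinj : ∀ m m' : ZMod N, ζ ^ m.val = ζ ^ m'.val → m = m' := fun m m' h =>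
    ZMod.val_injective N (hζ.pow_inj m.val_lt m'.val_lt h)
  have hadd : ∀ m m' : ZMod N, ζ ^ (m + m').val = ζ ^ m.val * ζ ^ m'.val := by
    intro m m'
    rw [ZMod.val_add, ← pow_add]
    exact (pow_eq_pow_mod _ hζ.pow_eq_one).symm
  have hsurj : ∀ η : ℂ, η ^ N = 1 → ∃ m : ZMod N, ζ ^ m.val = η := by
    intro η h
    obtain ⟨i, hi, h⟩ := hζ.eq_pow_of_pow_eq_one h
    exact ⟨(i : ZMod N), by rw [ZMod.val_natCast_of_lt hi, h]⟩
  classical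
  let ι : (ℂ × ℂ → ℂ × ℂ) → ZMod N := fun L =>
    if h : ∃ m : ZMod N, ζ ^ m.val = (L (1, 0)).1 then h.choose else 0
  have hι : ∀ (L : ℂ × ℂ → ℂ × ℂ) (m : ZMod N), ζ ^ m.val = (L (1, 0)).1 → ι L = m := by
    intro L m h
    have hex : ∃ m : ZMod N, ζ ^ m.val = (L (1, 0)).1 := ⟨m, h⟩
    have : ι L = hex.choose := dif_pos hex
    rw [this]
    exact hinj _ _ (hex.choose_spec.trans h.symm)
  have hform : ∀ L : ℂ × ℂ → ℂ × ℂ, IsAffine L →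
      L '' {z : ℂ × ℂ | G z < c} = {z : ℂ × ℂ | G z < c} →
      ∀ z : ℂ × ℂ, L z = (ζ ^ (ι L).val * z.1, (ζ ^ (ι L).val) ^ d * z.2) := by
    intro L hL hLG z
    obtain ⟨η, hη, h⟩ := (hmain L hL).mp hLG
    obtain ⟨m, hm⟩ := hsurj η hη
    have : ι L = m := hι L m (by rw [hm, h]; simp)
    rw [this, hm, h]
  clear_value ι
  refine ⟨ι, ?_, ?_, ?_⟩
  · intro L L' h1 h2 h3 h4
    apply hι
    rw [hadd, Function.comp, hform L h1 h2, hform L' h3 h4]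
    simp
  · intro L L' h1 h2 h3 h4 h
    funext z
    rw [hform L h1 h2, hform L' h3 h4, h]
  · intro m
    have hA : IsAffine (fun z => (ζ ^ m.val * z.1, (ζ ^ m.val) ^ d * z.2)) :=
      ⟨ζ ^ m.val, 0, 0, 0, (ζ ^ m.val) ^ d, 0, fun z => by simp⟩
    refine ⟨_, hA, (hmain _ hA).mpr ⟨ζ ^ m.val, ?_, fun z => rfl⟩, ?_⟩
    · rw [← pow_mul, mul_comm, pow_mul, hζ.pow_eq_one, one_pow]
    · apply hι
      exact (mul_one _).symm
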